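/- For every positive integer m, multi-indices n, z ∈ ℕ^m, natural numbers p, q with p ≥ n·z and q ≥ 1, and every 1 ≤ i ≤ m and 1 ≤ j ≤ z_i, one has ∑_{k=0}^{n} C(p − k·z + j − 1, k − e_i) · C(q + k·z − j, n − k) = ∑_{k=0}^{n} C(p − k·z − 1, k − e_i) · C(q + k·z, n − k), where C(x, k − e_i) = 0 if k_i = 0. -/

import Mathlib

/-- The multinomial coefficient `C(x, k) = x(x-1)⋯(x-|k|+1)/k!` for `x : ℝ`
and a multi-index `k : Fin m → ℕ`. -/
noncomputable def mchoose {m : ℕ} (x : ℝ) (k : Fin m → ℕ) : ℝ :=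
  (∏ j ∈ Finset.range (∑ i, k i), (x - (j : ℝ))) / ∏ i, (Nat.factorial (k i) : ℝ)

/-- The multinomial coefficient `C(x, k − eᵢ)`, with the convention that it is `0`
when `kᵢ = 0` (i.e. when `k − eᵢ` has a negative component). -/
noncomputable def mchooseSub {m : ℕ} (x : ℝ) (k : Fin m → ℕ) (i : Fin m) : ℝ :=
  if k i = 0 then 0 else mchoose x (k - Pi.single i 1)

/-- The dot product `k·z = k₁z₁ + ⋯ + kₘzₘ` of multi-indices. -/
def mdot {m : ℕ} (k z : Fin m → ℕ) : ℕ := ∑ i, k i * z i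

theorem mchooseSub_add_single {m : ℕ} (x : ℝ) (k : Fin m → ℕ) (i : Fin m) :
    mchooseSub x (k + Pi.single i 1) i = mchoose x k := by
  simp [mchooseSub]

theorem mchooseSub_of_eq_zero {m : ℕ} (x : ℝ) {k : Fin m → ℕ} {i : Fin m} (h : k i = 0) :
    mchooseSub x k i = 0 := by
  simp [mchooseSub, h]

theorem mdot_add_single {m : ℕ} (k z : Fin m → ℕ) (i : Fin m) :
    mdot (k + Pi.single i 1) z = mdot k z + z i := by
  simp [mdot, add_mul, Finset.sum_add_distrib, Pi.single_apply]

theorem exists_eq_add_single {m : ℕ} {k : Fin m → ℕ} {i : Fin m} (h : k i ≠ 0) :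
    ∃ l : Fin m → ℕ, k = l + Pi.single i 1 := by
  refine ⟨k - Pi.single i 1, funext fun a => ?_⟩
  by_cases ha : a = i
  · subst ha
    simp only [Pi.add_apply, Pi.sub_apply, Pi.single_eq_same]
    omega
  · simp [ha]

theorem prod_factorial_add_single {m : ℕ} (k : Fin m → ℕ) (i : Fin m) :
    ∏ a, (Nat.factorial ((k + Pi.single i 1 : Fin m → ℕ) a) : ℝ) =
      (k i + 1 : ℕ) * ∏ a, (Nat.factorial (k a) : ℝ) := by
  rw [← Finset.mul_prod_erase _ _ (Finset.mem_univ i),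
    ← Finset.mul_prod_erase _ (fun a => (Nat.factorial (k a) : ℝ)) (Finset.mem_univ i), ← mul_assoc]
  congr 1
  · simp [Nat.factorial_succ]
  · refine Finset.prod_congr rfl fun a ha => ?_
    simp [Finset.ne_of_mem_erase ha]

theorem mchooseSub_eq_mul_div {m : ℕ} (x : ℝ) (k : Fin m → ℕ) (i : Fin m) (M : ℕ)
    (hM : ∑ a, k a = M + 1) :
    mchooseSub x k i =
      (∏ j ∈ Finset.range M, (x - (j : ℝ))) * k i / ∏ a, (Nat.factorial (k a) : ℝ) := by
  by_cases h : k i = 0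
  · simp [mchooseSub_of_eq_zero x h, h]
  · obtain ⟨l, rfl⟩ := exists_eq_add_single h
    have hl : ∑ a, l a = M := by
      simpa [Finset.sum_add_distrib] using hM
    have hpos : ∏ a, (Nat.factorial (l a) : ℝ) ≠ 0 :=
      Finset.prod_ne_zero_iff.mpr fun a _ => Nat.cast_ne_zero.mpr (Nat.factorial_ne_zero _)
    have hsucc : ((l i + 1 : ℕ) : ℝ) ≠ 0 := Nat.cast_ne_zero.mpr (Nat.succ_ne_zero _)
    rw [mchooseSub_add_single, prod_factorial_add_single, mchoose, hl]
    simp only [Pi.add_apply, Pi.single_eq_same]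
    field_simp

/-- Pascal's rule for multinomial coefficients. -/
theorem mchoose_add_one {m : ℕ} (x : ℝ) (k : Fin m → ℕ) :
    mchoose (x + 1) k = mchoose x k + ∑ i, mchooseSub x k i := by
  rcases hN : ∑ a, k a with _ | M
  · have hk : ∀ i, k i = 0 := by simpa using hN
    simp [mchoose, hN, mchooseSub_of_eq_zero _ (hk _)]
  · have hcast : ∑ a, (k a : ℝ) = M + 1 := by exact_mod_cast hN
    simp_rw [mchooseSub_eq_mul_div x k _ M hN]
    rw [← Finset.sum_div, ← Finset.mul_sum, hcast, mchoose, mchoose, hN, ← add_div]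
    congr 1
    rw [Finset.prod_range_succ', Finset.prod_range_succ]
    have hshift : ∀ j : ℕ, x + 1 - ((j + 1 : ℕ) : ℝ) = x - j := fun j => by push_cast; ring
    simp_rw [hshift]
    push_cast
    ring

theorem sum_Iic_add_single_of_eq_zero {m : ℕ} (n : Fin m → ℕ) (i : Fin m)
    (F : (Fin m → ℕ) → ℝ) (hF : ∀ k, k i = 0 → F k = 0) :
    ∑ k ∈ Finset.Iic (n + Pi.single i 1), F k = ∑ k ∈ Finset.Iic n, F (k + Pi.single i 1) := by
  symm
  refine Finset.sum_of_injOn (· + Pi.single i 1) (fun a _ b _ h => add_right_cancel h) ?_ ?_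
    fun _ _ => rfl
  · intro k hk
    simpa using hk
  · intro k hk hk'
    refine hF k ?_
    by_contra h
    obtain ⟨l, rfl⟩ := exists_eq_add_single h
    exact hk' ⟨l, by simpa using hk, rfl⟩

theorem sum_Iic_add_single_sub {m : ℕ} (n : Fin m → ℕ) (i : Fin m)
    (f g : (Fin m → ℕ) → ℝ) :
    ∑ k ∈ Finset.Iic (n + Pi.single i 1), f k * mchooseSub (g k) (n + Pi.single i 1 - k) i =
      ∑ k ∈ Finset.Iic n, f k * mchoose (g k) (n - k) := by
  symm
  have hle : n ≤ n + Pi.single i 1 := le_self_add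
  rw [← Finset.sum_subset (Finset.Iic_subset_Iic.mpr hle)]
  · refine Finset.sum_congr rfl fun k hk => ?_
    rw [tsub_add_eq_add_tsub (Finset.mem_Iic.mp hk) |>.symm, mchooseSub_add_single]
  · intro k hk hk'
    rw [Finset.mem_Iic] at hk hk'
    rw [mchooseSub_of_eq_zero, mul_zero]
    by_contra h
    refine hk' fun a => ?_
    have ha := hk a
    by_cases hai : a = i
    · subst hai
      simp only [Pi.add_apply, Pi.sub_apply, Pi.single_eq_same] at h
      change k a ≤ n a
      omega
    · simpa [hai] using ha

/-- The convolution `∑ₖ C(x − k·z, k) C(y + k·z, n − k)`. -/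
noncomputable def mchooseConv {m : ℕ} (z n : Fin m → ℕ) (x y : ℝ) : ℝ :=
  ∑ k ∈ Finset.Iic n, mchoose (x - (mdot k z : ℕ)) k * mchoose (y + (mdot k z : ℕ)) (n - k)

theorem sum_mchooseSub_mul_mchoose {m : ℕ} (z n : Fin m → ℕ) (i : Fin m) (x y : ℝ) :
    ∑ k ∈ Finset.Iic (n + Pi.single i 1), mchooseSub (x - (mdot k z : ℕ)) k i *
        mchoose (y + (mdot k z : ℕ)) (n + Pi.single i 1 - k) =
      mchooseConv z n (x - z i) (y + z i) := by
  rw [sum_Iic_add_single_of_eq_zero n i _ fun k hk => by rw [mchooseSub_of_eq_zero _ hk, zero_mul],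
    mchooseConv]
  refine Finset.sum_congr rfl fun k _ => ?_
  rw [mchooseSub_add_single, mdot_add_single, add_tsub_add_eq_tsub_right]
  push_cast
  congr 2 <;> ring

theorem mchooseConv_add_natCast_of_add_one {m : ℕ} {z n : Fin m → ℕ}
    (h : ∀ x y, mchooseConv z n (x + 1) y = mchooseConv z n x (y + 1)) (c : ℕ) (x y : ℝ) :
    mchooseConv z n (x + c) y = mchooseConv z n x (y + c) := by
  induction c generalizing y with
  | zero => simp
  | succ c ih =>
    push_cast
    rw [← add_assoc, h, ih]
    congr 1
    ring

theorem mchooseConv_add_one {m : ℕ} (z n : Fin m → ℕ) (x y : ℝ) :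
    mchooseConv z n (x + 1) y = mchooseConv z n x (y + 1) := by
  induction n using WellFoundedLT.induction generalizing x y with
  | ind n ih =>
    have hl : mchooseConv z n (x + 1) y = mchooseConv z n x y +
        ∑ i, ∑ k ∈ Finset.Iic n,
          mchooseSub (x - (mdot k z : ℕ)) k i * mchoose (y + (mdot k z : ℕ)) (n - k) := by
      rw [mchooseConv, mchooseConv, Finset.sum_comm, ← Finset.sum_add_distrib]
      refine Finset.sum_congr rfl fun k _ => ?_
      rw [add_sub_right_comm, mchoose_add_one, add_mul, Finset.sum_mul]
    have hr : mchooseConv z n x (y + 1) = mchooseConv z n x y +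
        ∑ i, ∑ k ∈ Finset.Iic n,
          mchoose (x - (mdot k z : ℕ)) k * mchooseSub (y + (mdot k z : ℕ)) (n - k) i := by
      rw [mchooseConv, mchooseConv, Finset.sum_comm, ← Finset.sum_add_distrib]
      refine Finset.sum_congr rfl fun k _ => ?_
      rw [add_right_comm, mchoose_add_one, mul_add, Finset.mul_sum]
    rw [hl, hr]
    congr 1
    refine Finset.sum_congr rfl fun i _ => ?_
    by_cases hn : n i = 0
    · refine Finset.sum_congr rfl fun k hk => ?_
      have hki : k i = 0 := Nat.le_zero.mp (hn ▸ Finset.mem_Iic.mp hk i)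
      rw [mchooseSub_of_eq_zero _ hki, mchooseSub_of_eq_zero _ (by simp [hn]), zero_mul, mul_zero]
    · obtain ⟨l, rfl⟩ := exists_eq_add_single hn
      have hlt : l < l + Pi.single i 1 := by
        refine lt_of_le_of_ne le_self_add fun h => ?_
        simpa using congrFun h i
      rw [sum_mchooseSub_mul_mchoose, sum_Iic_add_single_sub, ← mchooseConv,
        ← mchooseConv_add_natCast_of_add_one (ih l hlt), sub_add_cancel]

theorem mchooseConv_add_natCast {m : ℕ} (z n : Fin m → ℕ) (c : ℕ) (x y : ℝ) :
    mchooseConv z n (x + c) y = mchooseConv z n x (y + c) :=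
  mchooseConv_add_natCast_of_add_one (mchooseConv_add_one z n) c x y

/-- **Equation (3.2)**: for `p ≥ n·z`, `q ≥ 1`, `1 ≤ i ≤ m` and `1 ≤ j ≤ zᵢ`,
`∑_{k=0}^{n} C(p − k·z + j − 1, k − eᵢ) · C(q + k·z − j, n − k)
  = ∑_{k=0}^{n} C(p − k·z − 1, k − eᵢ) · C(q + k·z, n − k)`. -/
theorem shifted_sum_identity (m : ℕ) (hm : 0 < m) (n z : Fin m → ℕ)
    (p q : ℕ) (hp : mdot n z ≤ p) (hq : 1 ≤ q) (i : Fin m) (j : ℕ)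
    (hj1 : 1 ≤ j) (hjz : j ≤ z i) :
    ∑ k ∈ Finset.Iic n,
        mchooseSub ((p : ℝ) - (mdot k z : ℕ) + (j : ℝ) - 1) k i *
          mchoose ((q : ℝ) + (mdot k z : ℕ) - (j : ℝ)) (n - k) =
      ∑ k ∈ Finset.Iic n,
        mchooseSub ((p : ℝ) - (mdot k z : ℕ) - 1) k i *
          mchoose ((q : ℝ) + (mdot k z : ℕ)) (n - k) := by
  by_cases hn : n i = 0
  · refine Finset.sum_congr rfl fun k hk => ?_
    have hki : k i = 0 := Nat.le_zero.mp (hn ▸ Finset.mem_Iic.mp hk i)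
    simp [mchooseSub_of_eq_zero _ hki]
  · obtain ⟨l, rfl⟩ := exists_eq_add_single hn
    have hleft := sum_mchooseSub_mul_mchoose z l i ((p : ℝ) + j - 1) ((q : ℝ) - j)
    have hright := sum_mchooseSub_mul_mchoose z l i ((p : ℝ) - 1) (q : ℝ)
    have hshift := mchooseConv_add_natCast z l j ((p : ℝ) - 1 - z i) ((q : ℝ) - j + z i)
    rw [show (p : ℝ) - 1 - z i + j = p + j - 1 - z i by ring,
      show (q : ℝ) - j + z i + j = q + z i by ring] at hshift
    have hp_left (k : Fin m → ℕ) :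
        (p : ℝ) - (mdot k z : ℕ) + j - 1 = p + j - 1 - (mdot k z : ℕ) := by ring
    have hp_right (k : Fin m → ℕ) :
        (p : ℝ) - (mdot k z : ℕ) - 1 = p - 1 - (mdot k z : ℕ) := by ring
    have hq_left (k : Fin m → ℕ) :
        (q : ℝ) + (mdot k z : ℕ) - j = q - j + (mdot k z : ℕ) := by ring
    simp only [hp_left, hp_right, hq_left]
    exact hleft.trans (hshift.trans hright.symm)
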